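/- There exists a constant c > 0 such that for every sufficiently large n ∈ 16ℕ: Σ_{j∈ℕ(n)} ‖Δ_j( v_{0,n} (∂_x v_{0,n})² )‖_{L^∞(𝕋)} ≥ c (log n)². -/

import Mathlib

open MeasureTheory Filter Function
open scoped ENNReal NNReal

noncomputable section

/-- The Fourier coefficient `û(ξ) = ∫_{-π}^{π} e^{-i x ξ} u(x) dx` of a `2π`-periodic
function on the torus. -/
def fCoeff (u : ℝ → ℂ) (ξ : ℤ) : ℂ :=
  ∫ x in (-Real.pi)..Real.pi, Complex.exp (-Complex.I * x * ξ) * u x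

/-- A Littlewood–Paley cutoff function: smooth, even, `0 ≤ χ ≤ 1`, `χ = 1` on `[-3/4,3/4]`,
`supp χ ⊆ (-4/3, 4/3)`, nonincreasing on `[0,∞)`. -/
structure LPCutoff where
  χ : ℝ → ℝ
  smooth : ContDiff ℝ (⊤ : ℕ∞) χ
  even : ∀ x, χ (-x) = χ x
  nonneg : ∀ x, 0 ≤ χ x
  le_one : ∀ x, χ x ≤ 1
  eq_one : ∀ x ∈ Set.Icc (-(3/4) : ℝ) (3/4 : ℝ), χ x = 1
  supp : ∀ x, χ x ≠ 0 → x ∈ Set.Ioo (-(4/3) : ℝ) (4/3 : ℝ)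
  decay : AntitoneOn χ (Set.Ici 0)

/-- `φ(ξ) = χ(ξ/2) - χ(ξ)`. -/
def LPCutoff.phi (c : LPCutoff) (x : ℝ) : ℝ := c.χ (x / 2) - c.χ x

/-- The dyadic block `Δ_j u` (for `j ≥ -1`). -/
def LPblock (c : LPCutoff) (j : ℤ) (u : ℝ → ℂ) (x : ℝ) : ℂ :=
  if j = -1 then
    (1 / (2 * Real.pi)) * ∑' ξ : ℤ, (c.χ ξ : ℂ) * fCoeff u ξ * Complex.exp (Complex.I * x * ξ)
  else
    (1 / (2 * Real.pi)) *
      ∑' ξ : ℤ, (c.phi ((2:ℝ) ^ (-j) * ξ) : ℂ) * fCoeff u ξ * Complex.exp (Complex.I * x * ξ)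

/-- The low-frequency cut-off `S_j u`. -/
def LPlow (c : LPCutoff) (j : ℤ) (u : ℝ → ℂ) (x : ℝ) : ℂ :=
  (1 / (2 * Real.pi)) *
    ∑' ξ : ℤ, (c.χ ((2:ℝ) ^ (-j) * ξ) : ℂ) * fCoeff u ξ * Complex.exp (Complex.I * x * ξ)

/-- The `L^∞(𝕋)` (sup) norm, with values in `ℝ≥0∞`. -/
def supNormE {E : Type*} [NormedAddCommGroup E] (f : ℝ → E) : ℝ≥0∞ :=
  ⨆ x : ℝ, (‖f x‖₊ : ℝ≥0∞)

/-- View a real-valued function as a complex-valued one. -/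
def toC (f : ℝ → ℝ) : ℝ → ℂ := fun x => (f x : ℂ)

/-- The `2π`-periodic square wave: `1/2` on `(0,π)`, `-1/2` on `(-π,0)`, `0` on `{-π,0,π}`. -/
def hFun (x : ℝ) : ℝ :=
  let y := x - 2 * Real.pi * ⌊(x + Real.pi) / (2 * Real.pi)⌋
  if y = 0 ∨ y = -Real.pi then 0 else if 0 < y then 1/2 else -1/2

/-- The low-frequency part `f_n = S_{n/2} h` (real-valued). -/
def fLow (c : LPCutoff) (n : ℕ) : ℝ → ℝ := fun x => (LPlow c ((n : ℤ) / 2) (toC hFun) x).re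

/-- The initial data `v_{0,n}` for the periodic Novikov equation. -/
def v0NV (c : LPCutoff) (n : ℕ) : ℝ → ℝ := fun x =>
  (2:ℝ) ^ (-(n:ℤ)) * (n:ℝ) ^ (-(1:ℝ)/4) * Real.log n * Real.cos ((2:ℝ) ^ (n:ℕ) * x) *
    (1 + (n:ℝ) ^ (-(1:ℝ)/4) * fLow c n x) + (n:ℝ) ^ (-(1:ℝ)/4)

def tE (m : ℤ) : ℝ → ℂ := fun x => Complex.exp (Complex.I * x * m)

def TP (S : Set ℤ) : Submodule ℂ (ℝ → ℂ) := Submodule.span ℂ (tE '' S)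

lemma tE_cont (m : ℤ) : Continuous (tE m) := by unfold tE; fun_prop

lemma tE_mul (m k : ℤ) : tE m * tE k = tE (m + k) := by
  funext x
  simp only [tE, Pi.mul_apply, ← Complex.exp_add]
  congr 1; push_cast; ring

lemma tE_mem {S : Set ℤ} {m : ℤ} (h : m ∈ S) : tE m ∈ TP S :=
  Submodule.subset_span ⟨m, h, rfl⟩

lemma TP_mono {S T : Set ℤ} (h : S ⊆ T) {u : ℝ → ℂ} (hu : u ∈ TP S) : u ∈ TP T :=
  Submodule.span_mono (Set.image_mono h) hu

lemma TP_mul {S T U : Set ℤ} {u w : ℝ → ℂ} (hu : u ∈ TP S) (hw : w ∈ TP T)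
    (h : ∀ s ∈ S, ∀ t ∈ T, s + t ∈ U) : u * w ∈ TP U := by
  have h1 : u * w ∈ TP S * TP T := Submodule.mul_mem_mul hu hw
  unfold TP at h1
  rw [Submodule.span_mul_span] at h1
  refine Submodule.span_mono ?_ h1
  rintro _ ⟨_, ⟨s, hs, rfl⟩, _, ⟨t, ht, rfl⟩, rfl⟩
  exact ⟨s + t, h s hs t ht, (tE_mul s t).symm⟩

lemma TP_cont {S : Set ℤ} {u : ℝ → ℂ} (hu : u ∈ TP S) : Continuous u := by
  unfold TP at hu
  induction hu using Submodule.span_induction with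
  | mem x h => obtain ⟨m, _, rfl⟩ := h; exact tE_cont m
  | zero => exact continuous_const
  | add x y _ _ hx hy => exact hx.add hy
  | smul a x _ hx => exact hx.const_smul a

lemma fCoeff_add {u w : ℝ → ℂ} (hu : Continuous u) (hw : Continuous w) (ξ : ℤ) :
    fCoeff (u + w) ξ = fCoeff u ξ + fCoeff w ξ := by
  unfold fCoeff
  rw [← intervalIntegral.integral_add]
  · simp only [Pi.add_apply, mul_add]
  · apply Continuous.intervalIntegrable; fun_prop
  · apply Continuous.intervalIntegrable; fun_prop

lemma fCoeff_smul (a : ℂ) (u : ℝ → ℂ) (ξ : ℤ) :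
    fCoeff (a • u) ξ = a * fCoeff u ξ := by
  unfold fCoeff
  rw [← intervalIntegral.integral_const_mul]
  congr 1; funext x; simp only [Pi.smul_apply, smul_eq_mul]; ring

lemma fCoeff_tE (m ξ : ℤ) : fCoeff (tE m) ξ = if m = ξ then 2 * (Real.pi : ℂ) else 0 := by
  unfold fCoeff tE
  have h0 : ∀ x : ℝ, Complex.exp (-Complex.I * x * ξ) * Complex.exp (Complex.I * x * m)
      = Complex.exp ((Complex.I * ((m - ξ : ℤ) : ℂ)) * x) := by
    intro x; rw [← Complex.exp_add]; congr 1; push_cast; ring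
  simp only [h0]
  split_ifs with h
  · subst h; simp; ring
  · have hne : Complex.I * ((m - ξ : ℤ) : ℂ) ≠ 0 := by
      apply mul_ne_zero Complex.I_ne_zero
      exact_mod_cast sub_ne_zero.mpr h
    rw [integral_exp_mul_complex hne]
    have : Complex.exp (Complex.I * ((m - ξ : ℤ) : ℂ) * (Real.pi : ℝ))
        = Complex.exp (Complex.I * ((m - ξ : ℤ) : ℂ) * ((-Real.pi : ℝ) : ℂ)) := by
      rw [Complex.exp_eq_exp_iff_exists_int]
      refine ⟨m - ξ, ?_⟩
      push_cast; ring
    rw [this]; simp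

lemma fCoeff_TP_zero {S : Set ℤ} {u : ℝ → ℂ} (hu : u ∈ TP S) {ξ : ℤ} (hξ : ξ ∉ S) :
    fCoeff u ξ = 0 := by
  have hu' := hu
  unfold TP at hu
  induction hu using Submodule.span_induction with
  | mem x h =>
    obtain ⟨m, hm, rfl⟩ := h
    rw [fCoeff_tE, if_neg]; rintro rfl; exact hξ hm
  | zero => simp [fCoeff]
  | add x y h1 h2 hx hy => rw [fCoeff_add (TP_cont h1) (TP_cont h2), hx h1, hy h2, add_zero]
  | smul a x h1 hx => rw [fCoeff_smul, hx h1, mul_zero]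

lemma fCoeff_even {u : ℝ → ℂ} (hu : ∀ x, u (-x) = u x) (ξ : ℤ) :
    fCoeff u (-ξ) = fCoeff u ξ := by
  unfold fCoeff
  have := intervalIntegral.integral_comp_neg (a := -Real.pi) (b := Real.pi)
    (fun x : ℝ => Complex.exp (-Complex.I * x * ξ) * u x)
  rw [neg_neg] at this
  rw [← this]
  congr 1; funext x; rw [hu]; congr 2; push_cast; ring

lemma cos_eq_tE (k : ℤ) : toC (fun x => Real.cos (k * x)) = (1/2 : ℂ) • (tE k + tE (-k)) := by
  funext x
  simp only [toC, tE, Pi.smul_apply, Pi.add_apply, smul_eq_mul, Complex.ofReal_cos, Complex.cos]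
  push_cast
  rw [show Complex.I * x * k = k * x * Complex.I by ring,
    show Complex.I * x * -k = -(k * x) * Complex.I by ring]
  ring

lemma sin_eq_tE (k : ℤ) :
    toC (fun x => Real.sin (k * x)) = (-Complex.I/2 : ℂ) • (tE k + (-1 : ℂ) • tE (-k)) := by
  funext x
  simp only [toC, tE, Pi.smul_apply, Pi.add_apply, smul_eq_mul, Complex.ofReal_sin, Complex.sin]
  push_cast
  rw [show Complex.I * x * k = k * x * Complex.I by ring,
    show Complex.I * x * -k = -(k * x) * Complex.I by ring]
  ring

lemma cos_TP {S : Set ℤ} (k : ℤ) (h1 : k ∈ S) (h2 : -k ∈ S) :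
    toC (fun x => Real.cos (k * x)) ∈ TP S := by
  rw [cos_eq_tE]
  exact Submodule.smul_mem _ _ (Submodule.add_mem _ (tE_mem h1) (tE_mem h2))

lemma sin_TP {S : Set ℤ} (k : ℤ) (h1 : k ∈ S) (h2 : -k ∈ S) :
    toC (fun x => Real.sin (k * x)) ∈ TP S := by
  rw [sin_eq_tE]
  exact Submodule.smul_mem _ _ (Submodule.add_mem _ (tE_mem h1)
    (Submodule.smul_mem _ _ (tE_mem h2)))

lemma fCoeff_sin (k ξ : ℤ) : fCoeff (toC (fun x => Real.sin (k * x))) ξ =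
    (-Complex.I * Real.pi) * ((if k = ξ then 1 else 0) - (if k = -ξ then 1 else 0)) := by
  rw [sin_eq_tE, fCoeff_smul, fCoeff_add (tE_cont _) ((tE_cont _).const_smul _), fCoeff_smul,
    fCoeff_tE, fCoeff_tE]
  have : (-k = ξ) ↔ (k = -ξ) := by omega
  simp only [this]
  split_ifs <;> ring

open scoped Pointwise in
lemma key_coeff (f f' : ℝ → ℝ) (hd : ∀ x, HasDerivAt f (f' x) x) (N D B : ℤ)
    (hN : 3 * D + B < N) (hD : 0 ≤ D) (hB : 0 ≤ B)
    (hf : toC f ∈ TP (Set.Icc (-D) D)) (hf' : toC f' ∈ TP (Set.Icc (-D) D))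
    (hodd : ∀ x, f (-x) = - f x) (hev : ∀ x, f' (-x) = f' x) (b a L : ℝ) (hb : b * N = a * L)
    (v : ℝ → ℝ) (hv : v = fun x => b * Real.cos (N * x) * (1 + a * f x) + a)
    (ξ : ℤ) (hξ : |ξ| ≤ B) :
    fCoeff (toC fun x => v x * (deriv v x) ^ 2) ξ - fCoeff (toC fun x => v x * (deriv v x) ^ 2) (-ξ)
      = (a ^ 4 * L ^ 2 : ℝ) * (fCoeff (toC f) ξ - fCoeff (toC f) (-ξ)) := by
  have hdv : ∀ x, deriv v x = -(a * L) * (Real.sin (N * x) * (1 + a * f x))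
      + b * a * (Real.cos (N * x) * f' x) := by
    intro x
    apply HasDerivAt.deriv
    rw [hv]
    have h1 : HasDerivAt (fun x : ℝ => Real.cos (N * x)) (-Real.sin (N * x) * (N * 1)) x :=
      ((hasDerivAt_id x).const_mul (N : ℝ)).cos
    have h2 : HasDerivAt (fun x => 1 + a * f x) (a * f' x) x :=
      ((hd x).const_mul a).const_add 1
    refine (((h1.const_mul b).mul h2).add_const a).congr_deriv ?_
    rw [← hb]; ring
  set g : ℝ → ℝ := fun x => 1 + a * f x with hg
  set H : Set ℤ := {m | |m - N| ≤ D ∨ |m + N| ≤ D} with hH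
  set G : Set ℤ := {m | B < |m|} with hG
  have mulC : ∀ p q : ℝ → ℝ, toC (fun x => p x * q x) = toC p * toC q := by
    intro p q; funext x; simp [toC]
  have h1TP : toC (fun _ => 1) ∈ TP (Set.Icc (-D) D) := by
    have : toC (fun _ => 1) = tE 0 := by funext x; simp [toC, tE]
    rw [this]; exact tE_mem ⟨by omega, hD⟩
  have hgTP : toC g ∈ TP (Set.Icc (-D) D) := by
    have : toC g = toC (fun _ => 1) + (a : ℂ) • toC f := by
      funext x; simp [toC, hg]
    rw [this]
    exact Submodule.add_mem _ h1TP (Submodule.smul_mem _ _ hf)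
  have hHmul : ∀ s ∈ ({N, -N} : Set ℤ), ∀ t ∈ Set.Icc (-D) D, s + t ∈ H := by
    rintro s (rfl | rfl) t ⟨h1, h2⟩ <;> simp only [hH, Set.mem_ofPred_eq, abs_le] <;> omega
  have hcos : toC (fun x => Real.cos (N * x)) ∈ TP {N, -N} := cos_TP N (by simp) (by simp)
  have hsin : toC (fun x => Real.sin (N * x)) ∈ TP {N, -N} := sin_TP N (by simp) (by simp)
  have hcos2 : toC (fun x => Real.cos ((2 * N : ℤ) * x)) ∈ TP {2 * N, - (2 * N)} :=
    cos_TP _ (by simp) (by simp)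
  have hsin2 : toC (fun x => Real.sin ((2 * N : ℤ) * x)) ∈ TP {2 * N, - (2 * N)} :=
    sin_TP _ (by simp) (by simp)
  have hCg : toC (fun x => Real.cos (N * x) * g x) ∈ TP H := by
    rw [mulC]; exact TP_mul hcos hgTP hHmul
  have hSg : toC (fun x => Real.sin (N * x) * g x) ∈ TP H := by
    rw [mulC]; exact TP_mul hsin hgTP hHmul
  have hCf : toC (fun x => Real.cos (N * x) * f' x) ∈ TP H := by
    rw [mulC]; exact TP_mul hcos hf' hHmul
  have hV : toC (deriv v) ∈ TP H := by
    have : toC (deriv v) = (-(a * L) : ℂ) • toC (fun x => Real.sin (N * x) * g x)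
        + (b * a : ℂ) • toC (fun x => Real.cos (N * x) * f' x) := by
      funext x; simp only [toC, hdv, Pi.add_apply, Pi.smul_apply, smul_eq_mul, hg]; push_cast; ring
    rw [this]
    exact Submodule.add_mem _ (Submodule.smul_mem _ _ hSg) (Submodule.smul_mem _ _ hCf)
  have hR1 : toC (fun x => Real.cos (N * x) * g x) * (toC (deriv v) * toC (deriv v)) ∈ TP G := by
    refine TP_mul (T := H + H) hCg (TP_mul hV hV (fun s hs t ht => Set.add_mem_add hs ht)) ?_
    rintro s hs _ ⟨t, ht, r, hr, rfl⟩
    simp only [hH, hG, Set.mem_ofPred_eq, abs_le, lt_abs] at *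
    omega
  have hGmul : ∀ s ∈ ({2 * N, -(2 * N)} : Set ℤ), ∀ t ∈ Set.Icc (-D) D + Set.Icc (-D) D,
      s + t ∈ G := by
    rintro s (rfl | rfl) _ ⟨t, ⟨h1, h2⟩, r, ⟨h3, h4⟩, rfl⟩ <;>
      simp only [hG, Set.mem_ofPred_eq, lt_abs] <;> omega
  have hR2 : toC (fun x => Real.cos ((2 * N : ℤ) * x)) * (toC g * toC g) ∈ TP G :=
    TP_mul hcos2 (TP_mul hgTP hgTP (fun s hs t ht => Set.add_mem_add hs ht)) hGmul
  have hR3 : toC (fun x => Real.sin ((2 * N : ℤ) * x)) * (toC g * toC f') ∈ TP G :=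
    TP_mul hsin2 (TP_mul hgTP hf' (fun s hs t ht => Set.add_mem_add hs ht)) hGmul
  have hR4 : toC (fun x => Real.cos ((2 * N : ℤ) * x)) * (toC f' * toC f') ∈ TP G :=
    TP_mul hcos2 (TP_mul hf' hf' (fun s hs t ht => Set.add_mem_add hs ht)) hGmul
  set R : ℝ → ℂ := (b : ℂ) • (toC (fun x => Real.cos (N * x) * g x) * (toC (deriv v) * toC (deriv v)))
    + (-(a ^ 3 * L ^ 2 / 2) : ℂ) • (toC (fun x => Real.cos ((2 * N : ℤ) * x)) * (toC g * toC g))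
    + (-(a ^ 3 * L * b) : ℂ) • (toC (fun x => Real.sin ((2 * N : ℤ) * x)) * (toC g * toC f'))
    + (a ^ 3 * b ^ 2 / 2 : ℂ) • (toC (fun x => Real.cos ((2 * N : ℤ) * x)) * (toC f' * toC f')) with hR
  have hRTP : R ∈ TP G :=
    Submodule.add_mem _ (Submodule.add_mem _ (Submodule.add_mem _ (Submodule.smul_mem _ _ hR1)
      (Submodule.smul_mem _ _ hR2)) (Submodule.smul_mem _ _ hR3)) (Submodule.smul_mem _ _ hR4)
  set Ev : ℝ → ℂ := toC (fun x => a ^ 3 * L ^ 2 / 2 * (1 + a ^ 2 * f x ^ 2)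
    + a ^ 3 * b ^ 2 / 2 * f' x ^ 2) with hEv
  have hfc := TP_cont hf
  have hfc' := TP_cont hf'
  have hEvc : Continuous Ev := by
    have : Ev = fun x => ((a ^ 3 * L ^ 2 / 2 : ℝ) : ℂ) * (1 + a ^ 2 * toC f x ^ 2)
      + ((a ^ 3 * b ^ 2 / 2 : ℝ) : ℂ) * toC f' x ^ 2 := by
      funext x; simp [hEv, toC]
    rw [this]; fun_prop
  have hEve : ∀ x, Ev (-x) = Ev x := by
    intro x; simp only [hEv, toC, hodd, hev]; push_cast; ring
  have hF : (toC fun x => v x * (deriv v x) ^ 2) =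
      (Ev + ((a ^ 4 * L ^ 2 : ℝ) : ℂ) • toC f) + R := by
    funext x
    have hreal : v x * (deriv v x) ^ 2 = (a ^ 3 * L ^ 2 / 2 * (1 + a ^ 2 * f x ^ 2)
      + a ^ 3 * b ^ 2 / 2 * f' x ^ 2) + a ^ 4 * L ^ 2 * f x
      + (b * (Real.cos (N * x) * g x * (deriv v x * deriv v x))
      - (a ^ 3 * L ^ 2 / 2) * (Real.cos ((2 * N : ℤ) * x) * (g x * g x))
      - (a ^ 3 * L * b) * (Real.sin ((2 * N : ℤ) * x) * (g x * f' x))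
      + (a ^ 3 * b ^ 2 / 2) * (Real.cos ((2 * N : ℤ) * x) * (f' x * f' x))) := by
      have e1 : v x = b * (Real.cos (N * x) * g x) + a := by rw [hv]; simp only [hg]; ring
      have e2 : Real.cos ((2 * N : ℤ) * x) = 2 * Real.cos (N * x) ^ 2 - 1 := by
        rw [← Real.cos_two_mul]; push_cast; ring_nf
      have e3 : Real.sin ((2 * N : ℤ) * x) = 2 * Real.sin (N * x) * Real.cos (N * x) := by
        rw [← Real.sin_two_mul]; push_cast; ring_nf
      have e4 : (deriv v x) ^ 2 = a ^ 2 * L ^ 2 * ((1 - Real.cos (N * x) ^ 2) * g x ^ 2)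
        - 2 * (a * L * b * a) * (Real.sin (N * x) * Real.cos (N * x) * (g x * f' x))
        + b ^ 2 * a ^ 2 * (Real.cos (N * x) ^ 2 * f' x ^ 2) := by
        rw [hdv, ← Real.sin_sq]; simp only [hg]; ring
      rw [e1, add_mul, e2, e3]
      have : a * (deriv v x) ^ 2 = _ := congrArg (a * ·) e4
      rw [this]
      simp only [hg]
      ring
    simp only [hEv, hR, Pi.add_apply, Pi.smul_apply, Pi.mul_apply, smul_eq_mul, toC]
    rw [hreal]; push_cast; ring
  have hζ : ∀ ζ : ℤ, |ζ| ≤ B → fCoeff (toC fun x => v x * (deriv v x) ^ 2) ζ =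
      fCoeff Ev ζ + ((a ^ 4 * L ^ 2 : ℝ) : ℂ) * fCoeff (toC f) ζ := by
    intro ζ h
    rw [hF, fCoeff_add (hEvc.add (hfc.const_smul _)) (TP_cont hRTP),
      fCoeff_add hEvc (hfc.const_smul _), fCoeff_smul,
      fCoeff_TP_zero hRTP (ξ := ζ) (by simp [hG]; exact h), add_zero]
  rw [hζ ξ hξ, hζ (-ξ) (by rwa [abs_neg]), fCoeff_even hEve]
  ring
def rr (ξ : ℤ) : ℝ := ∫ x in (0 : ℝ)..Real.pi, Real.sin (ξ * x)

lemma rr_eq (ξ : ℤ) : (ξ : ℝ) * rr ξ = 1 - Real.cos (ξ * Real.pi) := by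
  unfold rr
  rw [intervalIntegral.mul_integral_comp_mul_left (f := Real.sin), integral_sin]; simp

lemma rr_neg (ξ : ℤ) : rr (-ξ) = - rr ξ := by
  unfold rr
  rw [← intervalIntegral.integral_neg]
  congr 1; funext x; rw [← Real.sin_neg]; push_cast; ring_nf

lemma rr_nonneg (ξ : ℤ) (h : 0 < ξ) : 0 ≤ rr ξ := by
  have h1 := rr_eq ξ
  have h2 := Real.cos_le_one (ξ * Real.pi)
  have h3 : (0 : ℝ) < ξ := by exact_mod_cast h
  by_contra hc
  push Not at hc
  nlinarith

lemma rr_odd (l : ℕ) : ((2 * l + 1 : ℤ) : ℝ) * rr (2 * l + 1) = 2 := by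
  rw [rr_eq]
  have : (((2 * l + 1 : ℤ) : ℝ)) * Real.pi = Real.pi + l * (2 * Real.pi) := by push_cast; ring
  rw [this, Real.cos_add_nat_mul_two_pi, Real.cos_pi]; norm_num

lemma hFun_pos {x : ℝ} (h : x ∈ Set.Ioo 0 Real.pi) : hFun x = 1 / 2 := by
  have hp := Real.pi_pos
  have hfl : ⌊(x + Real.pi) / (2 * Real.pi)⌋ = 0 := by
    rw [Int.floor_eq_zero_iff]
    constructor
    · have := h.1; positivity
    · rw [div_lt_one (by positivity)]; linarith [h.2]
  unfold hFun
  simp only [hfl, Int.cast_zero, mul_zero, sub_zero]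
  rw [if_neg, if_pos h.1]
  rintro (h1 | h1) <;> linarith [h.1]

lemma hFun_neg {x : ℝ} (h : x ∈ Set.Ioo (-Real.pi) 0) : hFun x = -1 / 2 := by
  have hp := Real.pi_pos
  have hfl : ⌊(x + Real.pi) / (2 * Real.pi)⌋ = 0 := by
    rw [Int.floor_eq_zero_iff]
    constructor
    · have := h.1; apply div_nonneg <;> linarith
    · rw [div_lt_one (by positivity)]; linarith [h.2]
  unfold hFun
  simp only [hfl, Int.cast_zero, mul_zero, sub_zero]
  rw [if_neg, if_neg (by linarith [h.2])]
  rintro (h1 | h1) <;> linarith [h.1, h.2]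

lemma fCoeff_h (ξ : ℤ) : fCoeff (toC hFun) ξ = -Complex.I * rr ξ := by
  have hp := Real.pi_pos
  have e1 : Set.EqOn (fun x : ℝ => Complex.exp (-Complex.I * x * ξ) * (1 / 2))
      (fun x : ℝ => Complex.exp (-Complex.I * x * ξ) * toC hFun x) (Set.Ioo 0 Real.pi) := by
    intro x hx; simp only [toC, hFun_pos hx]; push_cast; ring
  have e2 : Set.EqOn (fun x : ℝ => Complex.exp (-Complex.I * x * ξ) * (-1 / 2))
      (fun x : ℝ => Complex.exp (-Complex.I * x * ξ) * toC hFun x) (Set.Ioo (-Real.pi) 0) := by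
    intro x hx; simp only [toC, hFun_neg hx]; push_cast; ring
  have i1 : IntervalIntegrable (fun x : ℝ => Complex.exp (-Complex.I * x * ξ) * (1 / 2))
      volume 0 Real.pi := by apply Continuous.intervalIntegrable; fun_prop
  have i2 : IntervalIntegrable (fun x : ℝ => Complex.exp (-Complex.I * x * ξ) * (-1 / 2))
      volume (-Real.pi) 0 := by apply Continuous.intervalIntegrable; fun_prop
  unfold fCoeff
  rw [← intervalIntegral.integral_add_adjacent_intervals (b := 0)
    (i2.congr_uIoo (by rwa [Set.uIoo_of_le (by linarith)]))
    (i1.congr_uIoo (by rwa [Set.uIoo_of_le hp.le])),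
    ← intervalIntegral.integral_congr_Ioo_of_le (by linarith) e2,
    ← intervalIntegral.integral_congr_Ioo_of_le hp.le e1]
  have := intervalIntegral.integral_comp_neg (a := 0) (b := Real.pi)
    (fun x : ℝ => Complex.exp (-Complex.I * x * ξ) * (-1 / 2))
  rw [neg_zero] at this
  rw [← this, ← intervalIntegral.integral_add, rr, ← intervalIntegral.integral_ofReal,
    ← intervalIntegral.integral_const_mul]
  · congr 1; funext x
    rw [Complex.ofReal_sin, Complex.sin]
    push_cast
    rw [show -Complex.I * -(x:ℂ) * ξ = ξ * x * Complex.I by ring,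
      show -Complex.I * (x:ℂ) * ξ = -(ξ * x) * Complex.I by ring]
    linear_combination ((Complex.exp (-(ξ * x) * Complex.I) - Complex.exp (ξ * x * Complex.I)) / 2)
      * Complex.I_mul_I
  · apply Continuous.intervalIntegrable; fun_prop
  · exact i1

lemma chi_supp (c : LPCutoff) (p : ℕ) (ξ : ℤ) (h : c.χ ((2:ℝ) ^ (-(p:ℤ)) * ξ) ≠ 0) :
    ξ ∈ Finset.Icc (-(2 * 2 ^ p) : ℤ) (2 * 2 ^ p) := by
  obtain ⟨h1, h2⟩ := c.supp _ h
  have hp : (0:ℝ) < 2 ^ p := by positivity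
  rw [zpow_neg, zpow_natCast, inv_mul_eq_div] at h1 h2
  rw [lt_div_iff₀ hp] at h1
  rw [div_lt_iff₀ hp] at h2
  rw [Finset.mem_Icc]
  constructor
  · have : (-(2 * 2 ^ p) : ℝ) ≤ ξ := by linarith
    exact_mod_cast this
  · have : (ξ : ℝ) ≤ 2 * 2 ^ p := by linarith
    exact_mod_cast this

lemma phi_supp (c : LPCutoff) (p : ℕ) (ξ : ℤ) (h : c.phi ((2:ℝ) ^ (-(p:ℤ)) * ξ) ≠ 0) :
    3 / 4 < |(2:ℝ) ^ (-(p:ℤ)) * ξ| ∧ |(2:ℝ) ^ (-(p:ℤ)) * ξ| < 8 / 3 := by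
  set t := (2:ℝ) ^ (-(p:ℤ)) * ξ
  constructor
  · by_contra hc
    push Not at hc
    rw [abs_le] at hc
    apply h
    unfold LPCutoff.phi
    rw [c.eq_one t ⟨hc.1, hc.2⟩, c.eq_one (t/2) ⟨by linarith [hc.1], by linarith [hc.2]⟩, sub_self]
  · by_contra hc
    push Not at hc
    apply h
    unfold LPCutoff.phi
    have z : ∀ s, 4 / 3 ≤ |s| → c.χ s = 0 := by
      intro s hs
      by_contra hne
      have := c.supp s hne
      have : |s| < 4 / 3 := abs_lt.mpr ⟨this.1, this.2⟩
      linarith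
    rw [z t (by linarith), z (t/2) (by rw [abs_div, abs_two]; linarith), sub_self]

lemma phi_supp' (c : LPCutoff) (p : ℕ) (ξ : ℤ) (h : c.phi ((2:ℝ) ^ (-(p:ℤ)) * ξ) ≠ 0) :
    ξ ∈ Finset.Icc (-(3 * 2 ^ p) : ℤ) (3 * 2 ^ p) := by
  have h2 := (phi_supp c p ξ h).2
  have hp : (0:ℝ) < 2 ^ p := by positivity
  rw [zpow_neg, zpow_natCast, inv_mul_eq_div, abs_div, abs_of_pos hp, div_lt_iff₀ hp, abs_lt] at h2
  rw [Finset.mem_Icc]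
  constructor
  · have : (-(3 * 2 ^ p) : ℝ) ≤ ξ := by linarith
    exact_mod_cast this
  · have : (ξ : ℝ) ≤ 3 * 2 ^ p := by linarith
    exact_mod_cast this

lemma phi_even (c : LPCutoff) (t : ℝ) : c.phi (-t) = c.phi t := by
  unfold LPCutoff.phi
  rw [neg_div, c.even, c.even]

lemma phi_nonneg (c : LPCutoff) (t : ℝ) : 0 ≤ c.phi t := by
  wlog h : 0 ≤ t generalizing t
  · rw [← phi_even]; exact this _ (by linarith)
  · unfold LPCutoff.phi
    have := c.decay (a := t / 2) (b := t) (by simp only [Set.mem_Ici]; linarith) h (by linarith)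
    linarith

lemma phi_one (c : LPCutoff) (t : ℝ) (h1 : 4 / 3 ≤ t) (h2 : t ≤ 3 / 2) : c.phi t = 1 := by
  unfold LPCutoff.phi
  rw [c.eq_one (t/2) ⟨by linarith, by linarith⟩]
  have : c.χ t = 0 := by
    by_contra hne
    have := (c.supp t hne).2
    linarith
  rw [this]; ring

lemma term_nonneg (c : LPCutoff) (j : ℕ) (ξ : ℤ) :
    0 ≤ c.phi ((2:ℝ) ^ (-(j:ℤ)) * ξ) * rr ξ * Real.sin (ξ * (2:ℝ) ^ (-(j:ℤ))) := by
  wlog h : 0 ≤ ξ generalizing ξ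
  · have := this (-ξ) (by omega)
    rw [rr_neg] at this
    push_cast at this
    rw [mul_neg ((2:ℝ) ^ (-(j:ℤ))), phi_even, neg_mul, Real.sin_neg] at this
    linarith
  · by_cases hz : c.phi ((2:ℝ) ^ (-(j:ℤ)) * ξ) = 0
    · rw [hz]; simp
    · obtain ⟨h1, h2⟩ := phi_supp c j ξ hz
      have hq : (0:ℝ) < (2:ℝ) ^ (-(j:ℤ)) := by positivity
      have hξ : (0:ℝ) ≤ ξ := by exact_mod_cast h
      rw [abs_of_nonneg (by positivity)] at h1 h2
      have hpos : 0 < ξ := by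
        rcases h.lt_or_eq with h | h
        · exact h
        · rw [← h] at h1; norm_num at h1
      apply mul_nonneg (mul_nonneg (phi_nonneg _ _) (rr_nonneg _ hpos))
      apply Real.sin_nonneg_of_nonneg_of_le_pi (by positivity)
      rw [mul_comm]; linarith [Real.pi_gt_three]

lemma trig_lower (c : LPCutoff) (j : ℕ) (hj : 5 ≤ j) :
    1 / 24 ≤ ∑ ξ ∈ Finset.Icc (-(3 * 2 ^ j) : ℤ) (3 * 2 ^ j),
      c.phi ((2:ℝ) ^ (-(j:ℤ)) * ξ) * rr ξ * Real.sin (ξ * (2:ℝ) ^ (-(j:ℤ))) := by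
  obtain ⟨i, rfl⟩ := Nat.exists_eq_add_of_le hj
  set P : ℕ := 2 ^ i with hP
  have hPpos : 0 < P := by positivity
  have hQ : (2:ℕ) ^ (5 + i) = 32 * P := by rw [pow_add, ← hP]; norm_num
  have hQz : (2:ℤ) ^ (5 + i) = 32 * P := by exact_mod_cast hQ
  have hQr : (2:ℝ) ^ (5 + i) = 32 * P := by exact_mod_cast hQ
  have hPr : (0:ℝ) < P := by exact_mod_cast hPpos
  have hinj : Function.Injective (fun l : ℕ => (2 * l + 1 : ℤ)) := by
    intro a b h; simp only at h; omega
  have hsub : (Finset.Ico (22 * P) (24 * P)).map ⟨_, hinj⟩ ⊆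
      Finset.Icc (-(3 * 2 ^ (5 + i)) : ℤ) (3 * 2 ^ (5 + i)) := by
    intro ξ hξ
    rw [Finset.mem_map] at hξ
    obtain ⟨l, hl, rfl⟩ := hξ
    rw [Finset.mem_Ico] at hl
    rw [Finset.mem_Icc, hQz]
    simp only [Function.Embedding.coeFn_mk]
    omega
  refine le_trans ?_ (Finset.sum_le_sum_of_subset_of_nonneg hsub
    (fun ξ _ _ => term_nonneg c (5 + i) ξ))
  rw [Finset.sum_map]
  have hterm : ∀ l ∈ Finset.Ico (22 * P) (24 * P), 1 / (48 * P : ℝ) ≤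
      c.phi ((2:ℝ) ^ (-((5 + i : ℕ):ℤ)) * ((2 * l + 1 : ℤ) : ℝ)) * rr (2 * l + 1) *
        Real.sin (((2 * l + 1 : ℤ) : ℝ) * (2:ℝ) ^ (-((5 + i : ℕ):ℤ))) := by
    intro l hl
    rw [Finset.mem_Ico] at hl
    have l1 : (22 * P : ℝ) ≤ l := by exact_mod_cast hl.1
    have l2 : (l : ℝ) + 1 ≤ 24 * P := by exact_mod_cast hl.2
    have hr := rr_odd l
    rw [mul_comm _ ((2:ℝ) ^ _)]
    rw [zpow_neg, zpow_natCast, hQr, inv_mul_eq_div]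
    set s : ℝ := ((2 * l + 1 : ℤ) : ℝ) with hs
    have hs' : s = 2 * l + 1 := by rw [hs]; push_cast; ring
    have s1 : 44 * P ≤ s := by linarith
    have s2 : s ≤ 48 * P := by linarith
    have hspos : 0 < s := by linarith
    set t := s / (32 * P) with ht
    have t1 : 4 / 3 ≤ t := by rw [ht, le_div_iff₀ (by positivity)]; linarith
    have t2 : t ≤ 3 / 2 := by rw [ht, div_le_iff₀ (by positivity)]; linarith
    rw [phi_one c t t1 t2, one_mul]
    have hsin : 1 / 2 ≤ Real.sin t := by
      have := Real.mul_le_sin (x := t) (by linarith) (by linarith [Real.pi_gt_three])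
      refine le_trans ?_ this
      rw [div_mul_eq_mul_div, le_div_iff₀ Real.pi_pos]
      linarith [Real.pi_lt_four]
    have hrr : 1 / (24 * P : ℝ) ≤ rr (2 * l + 1) := by
      have : rr (2 * l + 1) = 2 / s := by rw [eq_div_iff hspos.ne', mul_comm]; exact hr
      rw [this, div_le_div_iff₀ (by positivity) hspos]
      linarith
    calc 1 / (48 * P : ℝ) = 1 / (24 * P) * (1 / 2) := by field_simp; norm_num
      _ ≤ _ := mul_le_mul hrr hsin (by norm_num) (le_trans (by positivity) hrr)
  refine le_trans ?_ (Finset.sum_le_sum hterm)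
  rw [Finset.sum_const, Nat.card_Ico, nsmul_eq_mul]
  have : ((24 * P - 22 * P : ℕ) : ℝ) = 2 * P := by
    rw [show 24 * P - 22 * P = 2 * P by omega]; push_cast; ring
  rw [this]
  apply le_of_eq; field_simp; norm_num

lemma block_lower (c : LPCutoff) (j : ℕ) (hj : 5 ≤ j) (F : ℝ → ℂ) (A : ℝ) (hA : 0 ≤ A)
    (hF : ∀ ξ : ℤ, |ξ| ≤ 3 * 2 ^ j → fCoeff F ξ - fCoeff F (-ξ) = A * (-2 * Complex.I * rr ξ)) :
    ENNReal.ofReal (A / (48 * Real.pi)) ≤ supNormE (LPblock c (j : ℤ) F) := by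
  have hp := Real.pi_pos
  set M : ℤ := 3 * 2 ^ j with hM
  have hblock : ∀ x : ℝ, LPblock c (j:ℤ) F x = (1 / (2 * Real.pi)) *
      ∑ ξ ∈ Finset.Icc (-M) M,
        (c.phi ((2:ℝ) ^ (-(j:ℤ)) * ξ) : ℂ) * fCoeff F ξ * Complex.exp (Complex.I * x * ξ) := by
    intro x
    unfold LPblock
    rw [if_neg (by omega)]
    congr 1
    apply tsum_eq_sum
    intro ξ hξ
    have : c.phi ((2:ℝ) ^ (-(j:ℤ)) * ξ) = 0 := by
      by_contra h
      exact hξ (phi_supp' c j ξ h)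
    rw [this]; simp
  set x : ℝ := (2:ℝ) ^ (-(j:ℤ)) with hx
  have hneg : LPblock c (j:ℤ) F (-x) = (1 / (2 * Real.pi)) *
      ∑ ξ ∈ Finset.Icc (-M) M,
        (c.phi (x * ξ) : ℂ) * fCoeff F (-ξ) * Complex.exp (Complex.I * x * ξ) := by
    rw [hblock]
    congr 1
    apply Finset.sum_equiv (Equiv.neg ℤ)
    · intro ξ; simp only [Finset.mem_Icc, Equiv.neg_apply]; omega
    · intro ξ _
      simp only [Equiv.neg_apply, neg_neg]
      push_cast
      rw [mul_neg x, phi_even]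
      congr 2; ring
  have hre : (LPblock c (j:ℤ) F x - LPblock c (j:ℤ) F (-x)).re = A / Real.pi *
      ∑ ξ ∈ Finset.Icc (-M) M, c.phi (x * ξ) * rr ξ * Real.sin (ξ * x) := by
    rw [hblock x, hneg, ← mul_sub, ← Finset.sum_sub_distrib]
    have : (1 / (2 * Real.pi) : ℂ) = ((1 / (2 * Real.pi) : ℝ) : ℂ) := by push_cast; ring
    rw [this, Complex.re_ofReal_mul, Complex.re_sum, Finset.mul_sum, Finset.mul_sum]
    apply Finset.sum_congr rfl
    intro ξ hξ
    rw [Finset.mem_Icc] at hξ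
    rw [← sub_mul, ← mul_sub, hF ξ (abs_le.mpr hξ),
      show Complex.I * (x:ℂ) * ξ = ((ξ * x : ℝ) : ℂ) * Complex.I by push_cast; ring,
      Complex.exp_mul_I, ← Complex.ofReal_cos, ← Complex.ofReal_sin]
    simp only [Complex.mul_re, Complex.mul_im, Complex.add_re, Complex.add_im, Complex.ofReal_re,
      Complex.ofReal_im, Complex.I_re, Complex.I_im, Complex.neg_re, Complex.neg_im,
      Complex.re_ofNat, Complex.im_ofNat]
    field_simp
    ring
  have hlow : A / (24 * Real.pi) ≤ ‖LPblock c (j:ℤ) F x‖ + ‖LPblock c (j:ℤ) F (-x)‖ := by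
    calc A / (24 * Real.pi) = A / Real.pi * (1 / 24) := by field_simp
      _ ≤ A / Real.pi * ∑ ξ ∈ Finset.Icc (-M) M, c.phi (x * ξ) * rr ξ * Real.sin (ξ * x) :=
        mul_le_mul_of_nonneg_left (trig_lower c j hj) (by positivity)
      _ = _ := hre.symm
      _ ≤ _ := Complex.re_le_norm _
      _ ≤ _ := norm_sub_le _ _
  have hex : ∃ y, A / (48 * Real.pi) ≤ ‖LPblock c (j:ℤ) F y‖ := by
    by_contra hc
    push Not at hc
    have e : A / (24 * Real.pi) = A / (48 * Real.pi) + A / (48 * Real.pi) := by field_simp; ring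
    linarith [hc x, hc (-x)]
  obtain ⟨y, hy⟩ := hex
  unfold supNormE
  refine le_trans ?_ (le_iSup _ y)
  change _ ≤ ‖LPblock c (j:ℤ) F y‖ₑ
  rw [← ofReal_norm]
  exact ENNReal.ofReal_le_ofReal hy
def cf (c : LPCutoff) (p : ℕ) (ξ : ℤ) : ℝ :=
  1 / (2 * Real.pi) * (c.χ ((2:ℝ) ^ (-(p:ℤ)) * ξ) * rr ξ)

lemma cf_neg (c : LPCutoff) (p : ℕ) (ξ : ℤ) : cf c p (-ξ) = - cf c p ξ := by
  unfold cf
  rw [rr_neg]; push_cast; rw [mul_neg ((2:ℝ) ^ (-(p:ℤ))), c.even]; ring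

lemma fLow_eq (c : LPCutoff) (n p : ℕ) (hp : n = 2 * p) :
    fLow c n = fun x => ∑ ξ ∈ Finset.Icc (-(2 * 2 ^ p) : ℤ) (2 * 2 ^ p),
      cf c p ξ * Real.sin (ξ * x) := by
  funext x
  unfold fLow LPlow
  have h2 : (n : ℤ) / 2 = p := by omega
  rw [h2, tsum_eq_sum (s := Finset.Icc (-(2 * 2 ^ p) : ℤ) (2 * 2 ^ p))]
  · have : (1 / (2 * Real.pi) : ℂ) = ((1 / (2 * Real.pi) : ℝ) : ℂ) := by push_cast; ring
    rw [this, Complex.re_ofReal_mul, Complex.re_sum, Finset.mul_sum]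
    apply Finset.sum_congr rfl
    intro ξ _
    rw [fCoeff_h, show Complex.I * (x:ℂ) * ξ = ((ξ * x : ℝ) : ℂ) * Complex.I by push_cast; ring,
      Complex.exp_mul_I, ← Complex.ofReal_cos, ← Complex.ofReal_sin, cf]
    simp only [Complex.mul_re, Complex.mul_im, Complex.add_re, Complex.add_im, Complex.ofReal_re,
      Complex.ofReal_im, Complex.I_re, Complex.I_im, Complex.neg_re, Complex.neg_im]
    ring
  · intro ξ hξ
    have : c.χ ((2:ℝ) ^ (-(p:ℤ)) * ξ) = 0 := by
      by_contra h
      exact hξ (chi_supp c p ξ h)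
    rw [this]; simp

lemma toC_sum (s : Finset ℤ) (w : ℤ → ℝ) (q : ℤ → ℝ → ℝ) :
    toC (fun x => ∑ ξ ∈ s, w ξ * q ξ x) = ∑ ξ ∈ s, (w ξ : ℂ) • toC (q ξ) := by
  funext x; simp [toC, Finset.sum_apply]

lemma fCoeff_sum (s : Finset ℤ) (w : ℤ → ℝ) (q : ℤ → ℝ → ℂ) (hq : ∀ ξ, Continuous (q ξ)) (η : ℤ) :
    fCoeff (∑ ξ ∈ s, (w ξ : ℂ) • q ξ) η = ∑ ξ ∈ s, (w ξ : ℂ) * fCoeff (q ξ) η := by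
  classical
  induction s using Finset.induction_on with
  | empty => simp [fCoeff]
  | insert a s ha ih =>
    rw [Finset.sum_insert ha, Finset.sum_insert ha, fCoeff_add ((hq a).const_smul _) ?_,
      fCoeff_smul, ih]
    exact Finset.sum_induction _ (fun u : ℝ → ℂ => Continuous u) (fun _ _ h1 h2 => h1.add h2)
      continuous_const (fun i _ => (hq i).const_smul (w i : ℂ))

lemma fCoeff_fLow (c : LPCutoff) (n p : ℕ) (hp : n = 2 * p) (η : ℤ)
    (hη : 4 * |η| ≤ 3 * 2 ^ p) :
    fCoeff (toC (fLow c n)) η = -Complex.I * rr η := by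
  rw [fLow_eq c n p hp, toC_sum _ (cf c p) (fun ξ x => Real.sin (ξ * x)), fCoeff_sum]
  · have hpos : (0:ℤ) < 2 ^ p := by positivity
    have hη' := abs_le.mp (show |η| ≤ 2 * 2 ^ p by omega)
    have m1 : η ∈ Finset.Icc (-(2 * 2 ^ p) : ℤ) (2 * 2 ^ p) := by
      rw [Finset.mem_Icc]; omega
    have m2 : -η ∈ Finset.Icc (-(2 * 2 ^ p) : ℤ) (2 * 2 ^ p) := by
      rw [Finset.mem_Icc]; omega
    simp only [fCoeff_sin, mul_sub, mul_ite, mul_one, mul_zero, Finset.sum_sub_distrib,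
      Finset.sum_ite_eq', m1, m2, if_true, cf_neg]
    have hchi : c.χ ((2:ℝ) ^ (-(p:ℤ)) * η) = 1 := by
      have hpr : (0:ℝ) < 2 ^ p := by positivity
      have h4 : 4 * |(η:ℝ)| ≤ 3 * 2 ^ p := by exact_mod_cast hη
      have : |(2:ℝ) ^ (-(p:ℤ)) * η| ≤ 3 / 4 := by
        rw [zpow_neg, zpow_natCast, inv_mul_eq_div, abs_div, abs_of_pos hpr, div_le_iff₀ hpr]
        linarith
      rw [abs_le] at this
      exact c.eq_one _ ⟨this.1, this.2⟩
    rw [cf, hchi]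
    have hpi : (Real.pi : ℂ) ≠ 0 := by exact_mod_cast Real.pi_ne_zero
    push_cast
    field_simp
    ring
  · intro ξ; unfold toC; fun_prop

theorem main_coeff (c : LPCutoff) (k : ℕ) (hk : 3 ≤ k) (ξ : ℤ) (hξ : |ξ| ≤ 3 * 2 ^ (4 * k)) :
    fCoeff (toC fun x => v0NV c (16 * k) x * (deriv (v0NV c (16 * k)) x) ^ 2) ξ -
      fCoeff (toC fun x => v0NV c (16 * k) x * (deriv (v0NV c (16 * k)) x) ^ 2) (-ξ) =
      (((Real.log (16 * k : ℕ)) ^ 2 / (16 * k : ℕ) : ℝ) : ℂ) * (-2 * Complex.I * rr ξ) := by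
  set n : ℕ := 16 * k with hn
  have hnpos : (0:ℝ) < n := by exact_mod_cast (by omega : 0 < n)
  set D : ℤ := 2 * 2 ^ (8 * k) with hD
  set q : ℤ := 2 ^ (4 * k) with hq
  have hq8 : (2:ℤ) ^ (8 * k) = q ^ 2 := by rw [hq, ← pow_mul]; congr 1; omega
  have hq16 : (2:ℤ) ^ n = q ^ 4 := by rw [hq, ← pow_mul]; congr 1; omega
  have hqge : 16 ≤ q := by
    rw [hq]
    calc (16:ℤ) = 2 ^ 4 := by norm_num
      _ ≤ 2 ^ (4 * k) := pow_le_pow_right₀ (by norm_num) (by omega)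
  set a : ℝ := (n:ℝ) ^ (-(1:ℝ)/4) with ha
  have ha4 : a ^ 4 = 1 / n := by
    rw [ha, ← Real.rpow_natCast, ← Real.rpow_mul hnpos.le]
    norm_num
    rw [Real.rpow_neg_one]
  set L : ℝ := Real.log n with hL
  have hfl := fLow_eq c n (8 * k) (by omega)
  set f' : ℝ → ℝ := fun x => ∑ ξ ∈ Finset.Icc (-(2 * 2 ^ (8 * k)) : ℤ) (2 * 2 ^ (8 * k)),
      (cf c (8 * k) ξ * ξ) * Real.cos (ξ * x) with hf'
  have key := key_coeff (fLow c n) f' ?_ (2 ^ n) D (3 * 2 ^ (4 * k)) ?_ (by positivity)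
    (by positivity) ?_ ?_ ?_ ?_ ((2:ℝ) ^ (-(n:ℤ)) * a * L) a L ?_ (v0NV c n) ?_ ξ hξ
  · rw [key, ha4, fCoeff_fLow c n (8 * k) (by omega) ξ, fCoeff_fLow c n (8 * k) (by omega) (-ξ),
      rr_neg]
    · push_cast; ring
    · rw [hq8, abs_neg]; nlinarith
    · rw [hq8]; nlinarith
  · intro x
    rw [hfl]
    apply HasDerivAt.fun_sum
    intro ξ _
    have h1 : HasDerivAt (fun x : ℝ => Real.sin (ξ * x)) (Real.cos (ξ * x) * (ξ * 1)) x :=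
      ((hasDerivAt_id x).const_mul (ξ : ℝ)).sin
    exact (h1.const_mul (cf c (8 * k) ξ)).congr_deriv (by ring)
  · rw [hD, hq16, hq8, ← hq]; nlinarith [sq_nonneg (q ^ 2 - 6), mul_pos (show 0 < q by omega) (show 0 < q by omega), pow_le_pow_left₀ (by norm_num) hqge 2]
  · rw [hfl, toC_sum _ (cf c (8 * k)) (fun ξ x => Real.sin (ξ * x))]
    refine Submodule.sum_mem _ fun ξ hξ => Submodule.smul_mem _ _ (sin_TP _ ?_ ?_) <;>
    rw [Finset.mem_Icc] at hξ <;> rw [Set.mem_Icc] <;> omega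
  · rw [hf', toC_sum _ (fun ξ => cf c (8 * k) ξ * ξ) (fun ξ x => Real.cos (ξ * x))]
    refine Submodule.sum_mem _ fun ξ hξ => Submodule.smul_mem _ _ (cos_TP _ ?_ ?_) <;>
    rw [Finset.mem_Icc] at hξ <;> rw [Set.mem_Icc] <;> omega
  · intro x
    rw [hfl]
    simp only [mul_neg, Real.sin_neg, Finset.sum_neg_distrib]
  · intro x
    simp only [hf', mul_neg, Real.cos_neg]
  · push_cast
    rw [zpow_neg, zpow_natCast]
    field_simp
  · funext x
    unfold v0NV
    push_cast
    rfl

/-- `Σ_{j ∈ ℕ(n)} ‖Δ_j(v_{0,n} (∂_x v_{0,n})²)‖_{L^∞} ≥ c (log n)²` for all sufficiently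
large `n ∈ 16ℕ`. -/
theorem v0NV_cubic_lower_bound (c : LPCutoff) :
    ∃ c₀ : ℝ, 0 < c₀ ∧ ∃ N : ℕ, ∀ n : ℕ, 16 ∣ n → N ≤ n →
      ENNReal.ofReal (c₀ * (Real.log n) ^ 2) ≤
        ∑ j ∈ Finset.Icc (n / 8) (n / 4),
          supNormE (LPblock c (j : ℤ) (toC fun x => v0NV c n x * (deriv (v0NV c n) x) ^ 2)) := by
  refine ⟨1 / 1536, by norm_num, 48, ?_⟩
  rintro n ⟨k, rfl⟩ hn
  have hk : 3 ≤ k := by omega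
  have hkr : (0:ℝ) < k := by exact_mod_cast (by omega : 0 < k)
  have h8 : 16 * k / 8 = 2 * k := by omega
  have h4 : 16 * k / 4 = 4 * k := by omega
  rw [h8, h4]
  set A : ℝ := (Real.log (16 * k : ℕ)) ^ 2 / (16 * k : ℕ) with hA
  have hApos : 0 ≤ A := by positivity
  have hb : ∀ j ∈ Finset.Icc (2 * k) (4 * k), ENNReal.ofReal (A / (48 * Real.pi)) ≤
      supNormE (LPblock c (j : ℤ)
        (toC fun x => v0NV c (16 * k) x * (deriv (v0NV c (16 * k)) x) ^ 2)) := by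
    intro j hj
    rw [Finset.mem_Icc] at hj
    refine block_lower c j (by omega) _ A hApos ?_
    intro ξ hξ
    refine main_coeff c k hk ξ (hξ.trans ?_)
    have : (2:ℤ) ^ j ≤ 2 ^ (4 * k) := pow_le_pow_right₀ (by norm_num) hj.2
    linarith
  refine le_trans ?_ (Finset.sum_le_sum hb)
  rw [Finset.sum_const, Nat.card_Icc, ← ENNReal.ofReal_nsmul, nsmul_eq_mul]
  apply ENNReal.ofReal_le_ofReal
  have hc : ((4 * k + 1 - 2 * k : ℕ) : ℝ) = 2 * k + 1 := by
    rw [show 4 * k + 1 - 2 * k = 2 * k + 1 by omega]; push_cast; ring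
  have hL : (Real.log (16 * k : ℕ)) ^ 2 = A * (16 * k) := by
    rw [hA]; push_cast; field_simp
  rw [hc, hL]
  have hpi := Real.pi_pos
  have h1 : A / 192 ≤ A / (48 * Real.pi) := by
    apply div_le_div_of_nonneg_left hApos (by positivity)
    linarith [Real.pi_lt_four]
  calc 1 / 1536 * (A * (16 * k)) = 2 * k * (A / 192) := by ring
    _ ≤ (2 * k + 1) * (A / (48 * Real.pi)) :=
      mul_le_mul (by linarith) h1 (by positivity) (by positivity)
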